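/- For fixed n and m ≥ 1, the functional Q_m : Ω^n → ℂ defined by Q_m(x_1,…,x_n) = n^{−(m−1)} Σ_{i_1,…,i_m ∈ {1,…,n}} Π_{j=1}^m F(x_{i_j} − x_{i_{j+1}}) (with i_{m+1} := i_1) is Lipschitz with constant 2m‖F‖_∞^m for the Hamming distance d(x,y) = Σ_{i=1}^n 1(x_i ≠ y_i) on Ω^n. -/

import Mathlib

open MeasureTheory ProbabilityTheory Filter Matrix
open scoped ENNReal NNReal BigOperators

noncomputable section

/-- The hypercube `Ω = [-1/2, 1/2]^d`. -/
def box (d : ℕ) : Set (Fin d → ℝ) := Set.univ.pi fun _ => Set.Icc (-(1/2) : ℝ) (1/2)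

/-- The uniform distribution on the hypercube. -/
def unif (d : ℕ) : Measure (Fin d → ℝ) := volume.restrict (box d)

/-- `F` is `1`-periodic. -/
def IsPeriodic {d : ℕ} (F : (Fin d → ℝ) → ℂ) : Prop :=
  ∀ (x : Fin d → ℝ) (u : Fin d → ℤ), F (x + fun j => (u j : ℝ)) = F x

/-- The character `x ↦ e^{2iπ k·x}`. -/
def ek {d : ℕ} (k : Fin d → ℤ) (x : Fin d → ℝ) : ℂ :=
  Complex.exp (2 * Real.pi * Complex.I * ∑ j, (k j : ℝ) * x j)

/-- The discrete Fourier coefficient `F̂(k) = ∫_Ω F(x) e^{-2iπ k·x} dx`. -/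
def Fhat {d : ℕ} (F : (Fin d → ℝ) → ℂ) (k : Fin d → ℤ) : ℂ :=
  ∫ x in box d, F x * Complex.exp (-(2 * Real.pi * Complex.I) * ∑ j, (k j : ℝ) * x j)

/-- The eigenvalues (with multiplicity) of a complex matrix, as the roots of
its characteristic polynomial. -/
def eigs {n : ℕ} (M : Matrix (Fin n) (Fin n) ℂ) : Multiset ℂ := M.charpoly.roots

/-- The matrix `A = (F(X_i - X_j))_{1 ≤ i,j ≤ n}`. -/
def ermMatrix {d : ℕ} {Ω : Type*} (F : (Fin d → ℝ) → ℂ) (X : ℕ → Ω → Fin d → ℝ)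
    (n : ℕ) (ω : Ω) : Matrix (Fin n) (Fin n) ℂ :=
  Matrix.of fun i j => F (X i.1 ω - X j.1 ω)

/-- The counting measure `μ_n = Σ_i δ_{λ_i(n)/n}` of eigenvalues scaled by `1/n`. -/
def specCounting {n : ℕ} (M : Matrix (Fin n) (Fin n) ℂ) : Measure ℂ :=
  ((eigs M).map fun z => Measure.dirac (z / (n : ℂ))).sum

/-- The limit counting measure `μ = Σ_{k ∈ ℤ^d} δ_{F̂(k)}`. -/
def limCounting {d : ℕ} (F : (Fin d → ℝ) → ℂ) : Measure ℂ :=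
  Measure.sum fun k : Fin d → ℤ => Measure.dirac (Fhat F k)

theorem sum_coord_aux (m n : ℕ) (j : Fin m) (g : Fin n → ℝ) :
    ∑ i : Fin m → Fin n, g (i j) = (n : ℝ) ^ (m - 1) * ∑ a, g a := by
  have h := Fintype.prod_sum (fun (k : Fin m) (a : Fin n) => if k = j then g a else 1)
  have h1 : ∀ i : Fin m → Fin n, ∏ k, (if k = j then g (i k) else 1) = g (i j) := by
    intro i
    rw [Finset.prod_ite_eq' Finset.univ j (fun k => g (i k))]
    simp
  simp only [h1] at h
  rw [← h, ← Finset.mul_prod_erase Finset.univ _ (Finset.mem_univ j), mul_comm]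
  congr 1
  · rw [Finset.prod_congr rfl (g := fun _ => (n : ℝ))]
    · simp
    · intro k hk
      simp [Finset.ne_of_mem_erase hk]
  · simp

/-- The functional `Q_m(x) = n^{-(m-1)} Σ_{i₁,…,i_m} Π_j F(x_{i_j} - x_{i_{j+1}})` is
`2m‖F‖_∞^m`-Lipschitz for the Hamming distance on `Ω^n`. -/
theorem trace_functional_hamming_lipschitz {d : ℕ} (hd : 1 ≤ d) (F : (Fin d → ℝ) → ℂ)
    (hFmeas : Measurable F) (hFbd : ∃ C, ∀ x, ‖F x‖ ≤ C)
    (hFper : IsPeriodic F)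
    (n : ℕ) (m : ℕ) [NeZero m]
    (Q : (Fin n → (Fin d → ℝ)) → ℂ)
    (hQ : ∀ x, Q x = ((n : ℂ) ^ (m - 1))⁻¹ *
      ∑ i : Fin m → Fin n, ∏ j : Fin m, F (x (i j) - x (i (j + 1)))) :
    ∀ x y : Fin n → (Fin d → ℝ), (∀ l, x l ∈ box d) → (∀ l, y l ∈ box d) →
      ‖Q x - Q y‖ ≤ 2 * m * (⨆ z : Fin d → ℝ, ‖F z‖) ^ m * hammingDist x y := by
  intro x y _ _
  set M := ⨆ z : Fin d → ℝ, ‖F z‖ with hM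
  have hb : ∀ z, ‖F z‖ ≤ M := by
    obtain ⟨C, hC⟩ := hFbd
    exact fun z => le_ciSup (f := fun z => ‖F z‖) ⟨C, by rintro _ ⟨z, rfl⟩; exact hC z⟩ z
  have hM0 : 0 ≤ M := (norm_nonneg _).trans (hb 0)
  have hP : ∀ (w : Fin n → (Fin d → ℝ)) (i : Fin m → Fin n),
      ‖∏ j : Fin m, F (w (i j) - w (i (j + 1)))‖ ≤ M ^ m := by
    intro w i
    rw [norm_prod]
    refine (Finset.prod_le_prod (fun _ _ => norm_nonneg _) (fun j _ => hb _)).trans ?_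
    simp
  set g : Fin n → ℝ := fun a => if x a ≠ y a then 1 else 0 with hg
  have hg0 : ∀ a, 0 ≤ g a := by intro a; simp only [hg]; split_ifs <;> norm_num
  have hgs : ∑ a, g a = hammingDist x y := by
    simp [hg, hammingDist, Finset.sum_ite, Finset.filter_not]
  have hd' : ∀ i : Fin m → Fin n,
      ‖∏ j : Fin m, F (x (i j) - x (i (j + 1))) - ∏ j : Fin m, F (y (i j) - y (i (j + 1)))‖
        ≤ 2 * M ^ m * ∑ j, g (i j) := by
    intro i
    by_cases h : ∀ j, x (i j) = y (i j)
    · simp only [h, sub_self, norm_zero]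
      have := Finset.sum_nonneg (fun j (_ : j ∈ Finset.univ) => hg0 (i j))
      positivity
    · push Not at h
      obtain ⟨j, hj⟩ := h
      have h1 : (1 : ℝ) ≤ ∑ j, g (i j) := by
        have := Finset.single_le_sum (f := fun j => g (i j)) (fun j _ => hg0 (i j))
          (Finset.mem_univ j)
        simpa [hg, hj] using this
      have h2 := norm_sub_le (∏ j : Fin m, F (x (i j) - x (i (j + 1))))
        (∏ j : Fin m, F (y (i j) - y (i (j + 1))))
      have h3 := hP x i
      have h4 := hP y i
      have h5 : 0 ≤ 2 * M ^ m := by positivity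
      nlinarith
  rw [hQ, hQ, ← mul_sub, ← Finset.sum_sub_distrib, norm_mul, norm_inv, norm_pow,
    Complex.norm_natCast]
  have hS : ‖∑ i : Fin m → Fin n, (∏ j : Fin m, F (x (i j) - x (i (j + 1)))
      - ∏ j : Fin m, F (y (i j) - y (i (j + 1))))‖
      ≤ (n : ℝ) ^ (m - 1) * (2 * m * M ^ m * hammingDist x y) := by
    refine (norm_sum_le _ _).trans ((Finset.sum_le_sum fun i _ => hd' i).trans ?_)
    rw [← Finset.mul_sum, Finset.sum_comm]
    simp only [sum_coord_aux, hgs]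
    simp only [Finset.sum_const, Finset.card_univ, Fintype.card_fin, nsmul_eq_mul]
    apply le_of_eq
    ring
  calc _ ≤ ((n : ℝ) ^ (m - 1))⁻¹ * ((n : ℝ) ^ (m - 1) * (2 * m * M ^ m * hammingDist x y)) := by
        gcongr
    _ = (((n : ℝ) ^ (m - 1))⁻¹ * (n : ℝ) ^ (m - 1)) * (2 * m * M ^ m * hammingDist x y) := by
        ring
    _ ≤ 1 * (2 * m * M ^ m * hammingDist x y) := by
        gcongr
        exact inv_mul_le_one
    _ = _ := one_mul _
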